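/- arXiv:2101.09448 — 8 statements merged into one kernel-verified Lean document; each statement's English description precedes it below -/
import Mathlib

section
/- Let R be a commutative ring and f₂, f₃ : R × R → R. The graph Γ_R(f₂, f₃) contains a cycle of length 6 if and only if there exist pairwise distinct a, b, c ∈ R and pairwise distinct x, y, z ∈ R such that f_i(a,x) − f_i(b,x) + f_i(b,y) − f_i(c,y) + f_i(c,z) − f_i(a,z) = 0 for i = 2 and i = 3. -/
/-- The algebraically defined bipartite graph `Γ_R(f₂, f₃)`: the first summand consists of
points `(a₁,a₂,a₃)`, the second of lines `[x₁,x₂,x₃]`; a point is adjacent to a line iff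
`a₂ + x₂ = f₂ (a₁, x₁)` and `a₃ + x₃ = f₃ (a₁, x₁)`. -/
def adGraph (R : Type*) [CommRing R] (f₂ f₃ : R × R → R) :
    SimpleGraph ((R × R × R) ⊕ (R × R × R)) :=
  SimpleGraph.fromRel (fun u v =>
    ∃ a x : R × R × R, u = Sum.inl a ∧ v = Sum.inr x ∧
      a.2.1 + x.2.1 = f₂ (a.1, x.1) ∧ a.2.2 + x.2.2 = f₃ (a.1, x.1))

section adGraph

variable {R : Type*} [CommRing R] {f₂ f₃ : R × R → R}

theorem adGraph_adj_inl_inr {p l : R × R × R} :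
    (adGraph R f₂ f₃).Adj (Sum.inl p) (Sum.inr l) ↔
      p.2.1 + l.2.1 = f₂ (p.1, l.1) ∧ p.2.2 + l.2.2 = f₃ (p.1, l.1) := by
  obtain ⟨a, b, c⟩ := p
  obtain ⟨x, y, z⟩ := l
  simp [adGraph, SimpleGraph.fromRel_adj]

theorem not_adGraph_adj_inl_inl {p q : R × R × R} :
    ¬ (adGraph R f₂ f₃).Adj (Sum.inl p) (Sum.inl q) := by
  simp [adGraph, SimpleGraph.fromRel_adj]

theorem not_adGraph_adj_inr_inr {l m : R × R × R} :
    ¬ (adGraph R f₂ f₃).Adj (Sum.inr l) (Sum.inr m) := by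
  simp [adGraph, SimpleGraph.fromRel_adj]

theorem fst_ne_of_adGraph_adj_of_ne_left {p q l : R × R × R}
    (hp : (adGraph R f₂ f₃).Adj (Sum.inl p) (Sum.inr l))
    (hq : (adGraph R f₂ f₃).Adj (Sum.inl q) (Sum.inr l)) (h : p ≠ q) : p.1 ≠ q.1 := by
  rw [adGraph_adj_inl_inr] at hp hq
  intro e
  rw [e] at hp
  exact h (Prod.ext e (Prod.ext (add_right_cancel (hp.1.trans hq.1.symm))
    (add_right_cancel (hp.2.trans hq.2.symm))))

theorem fst_ne_of_adGraph_adj_of_ne_right {p l m : R × R × R}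
    (hl : (adGraph R f₂ f₃).Adj (Sum.inl p) (Sum.inr l))
    (hm : (adGraph R f₂ f₃).Adj (Sum.inl p) (Sum.inr m)) (h : l ≠ m) : l.1 ≠ m.1 := by
  rw [adGraph_adj_inl_inr] at hl hm
  intro e
  rw [e] at hl
  exact h (Prod.ext e (Prod.ext (add_left_cancel (hl.1.trans hm.1.symm))
    (add_left_cancel (hl.2.trans hm.2.symm))))

theorem exists_alternating_sum_eq_zero_of_adGraph_hexagon {p q r l m n : R × R × R}
    (hpl : (adGraph R f₂ f₃).Adj (Sum.inl p) (Sum.inr l))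
    (hql : (adGraph R f₂ f₃).Adj (Sum.inl q) (Sum.inr l))
    (hqm : (adGraph R f₂ f₃).Adj (Sum.inl q) (Sum.inr m))
    (hrm : (adGraph R f₂ f₃).Adj (Sum.inl r) (Sum.inr m))
    (hrn : (adGraph R f₂ f₃).Adj (Sum.inl r) (Sum.inr n))
    (hpn : (adGraph R f₂ f₃).Adj (Sum.inl p) (Sum.inr n))
    (hpq : p ≠ q) (hpr : p ≠ r) (hqr : q ≠ r) (hlm : l ≠ m) (hln : l ≠ n) (hmn : m ≠ n) :
    ∃ a b c x y z : R, a ≠ b ∧ a ≠ c ∧ b ≠ c ∧ x ≠ y ∧ x ≠ z ∧ y ≠ z ∧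
      f₂ (a, x) - f₂ (b, x) + f₂ (b, y) - f₂ (c, y) + f₂ (c, z) - f₂ (a, z) = 0 ∧
      f₃ (a, x) - f₃ (b, x) + f₃ (b, y) - f₃ (c, y) + f₃ (c, z) - f₃ (a, z) = 0 := by
  refine ⟨p.1, q.1, r.1, l.1, m.1, n.1, fst_ne_of_adGraph_adj_of_ne_left hpl hql hpq,
    fst_ne_of_adGraph_adj_of_ne_left hpn hrn hpr, fst_ne_of_adGraph_adj_of_ne_left hqm hrm hqr,
    fst_ne_of_adGraph_adj_of_ne_right hql hqm hlm, fst_ne_of_adGraph_adj_of_ne_right hpl hpn hln,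
    fst_ne_of_adGraph_adj_of_ne_right hrm hrn hmn, ?_⟩
  rw [adGraph_adj_inl_inr] at hpl hql hqm hrm hrn hpn
  constructor
  · rw [← hpl.1, ← hql.1, ← hqm.1, ← hrm.1, ← hrn.1, ← hpn.1]
    ring
  · rw [← hpl.2, ← hql.2, ← hqm.2, ← hrm.2, ← hrn.2, ← hpn.2]
    ring

end adGraph

theorem SimpleGraph.exists_isCycle_length_six_iff {V : Type*} (G : SimpleGraph V) :
    (∃ (v : V) (w : G.Walk v v), w.IsCycle ∧ w.length = 6) ↔
      ∃ u₁ u₂ u₃ u₄ u₅ u₆ : V, G.Adj u₁ u₂ ∧ G.Adj u₂ u₃ ∧ G.Adj u₃ u₄ ∧ G.Adj u₄ u₅ ∧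
        G.Adj u₅ u₆ ∧ G.Adj u₆ u₁ ∧ [u₁, u₂, u₃, u₄, u₅, u₆].Nodup := by
  constructor
  · rintro ⟨v, w, hw, hlen⟩
    match w, hw, hlen with
    | .cons (v := u₂) h₁ (.cons (v := u₃) h₂ (.cons (v := u₄) h₃ (.cons (v := u₅) h₄
        (.cons (v := u₆) h₅ (.cons h₆ .nil))))), hw, _ =>
      refine ⟨v, u₂, u₃, u₄, u₅, u₆, h₁, h₂, h₃, h₄, h₅, h₆, ?_⟩
      have := hw.support_nodup
      simp only [Walk.support_cons, Walk.support_nil, List.tail_cons] at this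
      exact (List.perm_append_comm (l₁ := [v])).nodup_iff.mpr this
  · rintro ⟨u₁, u₂, u₃, u₄, u₅, u₆, h₁, h₂, h₃, h₄, h₅, h₆, hn⟩
    refine ⟨u₁, .cons h₁ (.cons h₂ (.cons h₃ (.cons h₄ (.cons h₅ (.cons h₆ .nil))))), ?_, rfl⟩
    rw [Walk.cons_isCycle_iff, Walk.isPath_def]
    constructor
    · exact (List.perm_append_comm (l₁ := [u₁])).nodup_iff.mp hn
    · simp only [List.nodup_cons, List.mem_cons, List.not_mem_nil, or_false, not_or] at hn
      simp
      grind

theorem six_cycle_iff (R : Type*) [CommRing R] (f₂ f₃ : R × R → R) :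
    (∃ (v : (R × R × R) ⊕ (R × R × R)) (w : (adGraph R f₂ f₃).Walk v v),
        w.IsCycle ∧ w.length = 6) ↔
      ∃ a b c x y z : R, a ≠ b ∧ a ≠ c ∧ b ≠ c ∧ x ≠ y ∧ x ≠ z ∧ y ≠ z ∧
        f₂ (a, x) - f₂ (b, x) + f₂ (b, y) - f₂ (c, y) + f₂ (c, z) - f₂ (a, z) = 0 ∧
        f₃ (a, x) - f₃ (b, x) + f₃ (b, y) - f₃ (c, y) + f₃ (c, z) - f₃ (a, z) = 0 := by
  rw [SimpleGraph.exists_isCycle_length_six_iff]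
  constructor
  · rintro ⟨u₁, u₂, u₃, u₄, u₅, u₆, h₁, h₂, h₃, h₄, h₅, h₆, hn⟩
    rcases u₁ with u₁ | u₁ <;> rcases u₂ with u₂ | u₂ <;>
      first
      | exact absurd h₁ not_adGraph_adj_inl_inl
      | exact absurd h₁ not_adGraph_adj_inr_inr
      | skip
    all_goals rcases u₃ with u₃ | u₃ <;>
      first
      | exact absurd h₂ not_adGraph_adj_inl_inl
      | exact absurd h₂ not_adGraph_adj_inr_inr
      | skip
    all_goals rcases u₄ with u₄ | u₄ <;>
      first
      | exact absurd h₃ not_adGraph_adj_inl_inl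
      | exact absurd h₃ not_adGraph_adj_inr_inr
      | skip
    all_goals rcases u₅ with u₅ | u₅ <;>
      first
      | exact absurd h₄ not_adGraph_adj_inl_inl
      | exact absurd h₄ not_adGraph_adj_inr_inr
      | skip
    all_goals rcases u₆ with u₆ | u₆ <;>
      first
      | exact absurd h₅ not_adGraph_adj_inl_inl
      | exact absurd h₅ not_adGraph_adj_inr_inr
      | skip
    all_goals
      simp only [List.nodup_cons, List.mem_cons, List.not_mem_nil, or_false, not_or,
        Sum.inl.injEq, Sum.inr.injEq] at hn
    · apply exists_alternating_sum_eq_zero_of_adGraph_hexagon h₁ h₂.symm h₃ h₄.symm h₅ h₆.symm <;>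
        tauto
    · apply exists_alternating_sum_eq_zero_of_adGraph_hexagon h₂ h₃.symm h₄ h₅.symm h₆ h₁.symm <;>
        grind
  · rintro ⟨a, b, c, x, y, z, hab, hac, hbc, hxy, hxz, hyz, e₂, e₃⟩
    refine ⟨.inl (a, 0, 0), .inr (x, f₂ (a, x), f₃ (a, x)),
      .inl (b, f₂ (b, x) - f₂ (a, x), f₃ (b, x) - f₃ (a, x)),
      .inr (y, f₂ (b, y) - f₂ (b, x) + f₂ (a, x), f₃ (b, y) - f₃ (b, x) + f₃ (a, x)),
      .inl (c, f₂ (c, z) - f₂ (a, z), f₃ (c, z) - f₃ (a, z)),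
      .inr (z, f₂ (a, z), f₃ (a, z)), ?_, SimpleGraph.Adj.symm ?_, ?_, SimpleGraph.Adj.symm ?_,
      ?_, SimpleGraph.Adj.symm ?_, ?_⟩
    · simp [adGraph_adj_inl_inr]
    · simp [adGraph_adj_inl_inr]
    · simp [adGraph_adj_inl_inr]
    · rw [adGraph_adj_inl_inr]
      exact ⟨by linear_combination e₂, by linear_combination e₃⟩
    · simp [adGraph_adj_inl_inr]
    · simp [adGraph_adj_inl_inr]
    · simp [hab, hac, hbc, hxy, hxz, hyz]
end

section
/- Let F be a field, f₂, f₃ : F × F → F, and let g : F → F and h : F → F be any functions. Then Γ_F(f₂, f₃) is isomorphic as a graph to Γ_F(f₂, f₃ + g + h), where (f₃ + g + h)(a,x) := f₃(a,x) + g(a) + h(x). -/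
/-- The permutation of points and lines that shifts the third coordinate of a point by `g` of its
first coordinate, and the third coordinate of a line by `h` of its first coordinate. -/
def shiftThird {R : Type*} [CommRing R] (g h : R → R) :
    ((R × R × R) ⊕ (R × R × R)) ≃ ((R × R × R) ⊕ (R × R × R)) where
  toFun := Sum.map (fun a => (a.1, a.2.1, a.2.2 + g a.1)) (fun x => (x.1, x.2.1, x.2.2 + h x.1))
  invFun := Sum.map (fun a => (a.1, a.2.1, a.2.2 - g a.1)) (fun x => (x.1, x.2.1, x.2.2 - h x.1))
  left_inv u := by rcases u with u | u <;> simp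
  right_inv u := by rcases u with u | u <;> simp

theorem add_add_add_eq_add_add_iff {R : Type*} [CommRing R] (a b c d e : R) :
    a + d + (b + e) = c + d + e ↔ a + b = c := by
  rw [add_add_add_comm, add_assoc c, add_left_inj]

theorem iso_add_separable (F : Type*) [Field F] (f₂ f₃ : F × F → F) (g h : F → F) :
    Nonempty (adGraph F f₂ f₃ ≃g adGraph F f₂ (fun p => f₃ p + g p.1 + h p.2)) := by
  refine ⟨⟨shiftThird g h, ?_⟩⟩
  rintro (u | u) (v | v) <;>
    simp [adGraph, shiftThird, SimpleGraph.fromRel_adj, -Prod.exists,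
      add_add_add_eq_add_add_iff]
end

section
/- Let s, t, u, v be positive integers. The graph Γ_ℝ(X^s Y^t, X^u Y^v) has girth four if and only if at least one of s, t is even and at least one of u, v is even. -/
/-- The real monomial graph `Γ_ℝ(X^s Y^t, X^u Y^v)`. -/
noncomputable def monGraph (s t u v : ℕ) : SimpleGraph ((ℝ × ℝ × ℝ) ⊕ (ℝ × ℝ × ℝ)) :=
  adGraph ℝ (fun p => p.1 ^ s * p.2 ^ t) (fun p => p.1 ^ u * p.2 ^ v)

theorem monGraph_adj_inl_inr {s t u v : ℕ} {a x : ℝ × ℝ × ℝ} :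
    (monGraph s t u v).Adj (Sum.inl a) (Sum.inr x) ↔
      a.2.1 + x.2.1 = a.1 ^ s * x.1 ^ t ∧ a.2.2 + x.2.2 = a.1 ^ u * x.1 ^ v := by
  constructor
  · rintro ⟨-, ⟨b, y, hb, hy, h⟩ | ⟨b, y, hb, hy, h⟩⟩
    · cases hb; cases hy; exact h
    · cases hb
  · intro h
    exact ⟨by simp, Or.inl ⟨a, x, rfl, rfl, h⟩⟩

theorem monGraph_not_adj_inl_inl {s t u v : ℕ} {a b : ℝ × ℝ × ℝ} :
    ¬ (monGraph s t u v).Adj (Sum.inl a) (Sum.inl b) := by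
  rintro ⟨-, ⟨_, _, _, h, _⟩ | ⟨_, _, _, h, _⟩⟩ <;> cases h

theorem monGraph_not_adj_inr_inr {s t u v : ℕ} {a b : ℝ × ℝ × ℝ} :
    ¬ (monGraph s t u v).Adj (Sum.inr a) (Sum.inr b) := by
  rintro ⟨-, ⟨_, _, h, _, _⟩ | ⟨_, _, h, _, _⟩⟩ <;> cases h

/-- Two points with two distinct common neighbours force one exponent of each monomial to be
even. -/
theorem even_of_monGraph_square {s t u v : ℕ} {a b x y : ℝ × ℝ × ℝ} (hab : a ≠ b) (hxy : x ≠ y)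
    (hax : (monGraph s t u v).Adj (Sum.inl a) (Sum.inr x))
    (hbx : (monGraph s t u v).Adj (Sum.inl b) (Sum.inr x))
    (hby : (monGraph s t u v).Adj (Sum.inl b) (Sum.inr y))
    (hay : (monGraph s t u v).Adj (Sum.inl a) (Sum.inr y)) :
    (Even s ∨ Even t) ∧ (Even u ∨ Even v) := by
  rw [monGraph_adj_inl_inr] at hax hbx hby hay
  obtain ⟨a₁, a₂, a₃⟩ := a
  obtain ⟨b₁, b₂, b₃⟩ := b
  obtain ⟨x₁, x₂, x₃⟩ := x
  obtain ⟨y₁, y₂, y₃⟩ := y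
  simp only at hax hbx hby hay
  have hab₁ : a₁ ≠ b₁ := by
    rintro rfl
    exact hab (by ext <;> simp <;> linarith)
  have hxy₁ : x₁ ≠ y₁ := by
    rintro rfl
    exact hxy (by ext <;> simp <;> linarith)
  have even_of_mul_eq_zero : ∀ {m n : ℕ}, (a₁ ^ m - b₁ ^ m) * (x₁ ^ n - y₁ ^ n) = 0 →
      Even m ∨ Even n := by
    intro m n h
    by_contra! hc
    simp only [Nat.not_even_iff_odd] at hc
    rcases mul_eq_zero.1 h with h | h
    · exact hab₁ (hc.1.strictMono_pow.injective (sub_eq_zero.1 h))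
    · exact hxy₁ (hc.2.strictMono_pow.injective (sub_eq_zero.1 h))
  exact ⟨even_of_mul_eq_zero (by linarith [hax.1, hbx.1, hby.1, hay.1]),
    even_of_mul_eq_zero (by linarith [hax.2, hbx.2, hby.2, hay.2])⟩

theorem monGraph_four_le_egirth (s t u v : ℕ) : 4 ≤ (monGraph s t u v).egirth := by
  rw [SimpleGraph.le_egirth]
  intro c w hw
  have h3 := hw.three_le_length
  have hne : w.length ≠ 3 := by
    intro h
    match w, h with
    | .cons (v := p) h₁ (.cons (v := q) h₂ (.cons h₃ .nil)), _ =>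
      rcases c with c | c <;> rcases p with p | p <;> rcases q with q | q <;>
        first
        | exact monGraph_not_adj_inl_inl ‹_›
        | exact monGraph_not_adj_inr_inr ‹_›
  exact_mod_cast (by omega : 4 ≤ w.length)

theorem even_of_monGraph_egirth_eq_four {s t u v : ℕ} (h : (monGraph s t u v).egirth = 4) :
    (Even s ∨ Even t) ∧ (Even u ∨ Even v) := by
  have hac : ¬ (monGraph s t u v).IsAcyclic := by
    rw [← SimpleGraph.egirth_eq_top, h]
    decide
  obtain ⟨c, w, hw, hl⟩ := SimpleGraph.exists_egirth_eq_length.2 hac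
  have hlen : w.length = 4 := by
    rw [h] at hl
    exact_mod_cast hl.symm
  match w, hlen with
  | .cons (v := p) h₁ (.cons (v := q) h₂ (.cons (v := r) h₃ (.cons h₄ .nil))), _ =>
    have hnd := hw.support_nodup
    simp only [SimpleGraph.Walk.support_cons, SimpleGraph.Walk.support_nil, List.tail_cons,
      List.nodup_cons, List.mem_cons, not_or] at hnd
    have hpr : p ≠ r := hnd.1.2.1
    have hqc : c ≠ q := fun e => hnd.2.1.2.1 e.symm
    rcases c with c | c <;> rcases p with p | p <;> rcases q with q | q <;> rcases r with r | r <;>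
      first
      | exact absurd ‹_› monGraph_not_adj_inl_inl
      | exact absurd ‹_› monGraph_not_adj_inr_inr
      | exact even_of_monGraph_square (fun e => hqc (congrArg _ e)) (fun e => hpr (congrArg _ e))
          h₁ h₂.symm h₃ h₄.symm
      | exact even_of_monGraph_square (fun e => hpr (congrArg _ e)) (fun e => hqc (congrArg _ e))
          h₁.symm h₄ h₃.symm h₂

theorem neg_one_pow_sub_mul_eq_zero {m n : ℕ} (h : Even m ∨ Even n) :
    ((-1 : ℝ) ^ m - 1) * ((-1) ^ n - 1) = 0 := by
  rcases h with h | h <;> simp [h.neg_one_pow]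

theorem monGraph_egirth_le_four {s t u v : ℕ} (hst : Even s ∨ Even t) (huv : Even u ∨ Even v) :
    (monGraph s t u v).egirth ≤ 4 := by
  have hst₀ := neg_one_pow_sub_mul_eq_zero hst
  have huv₀ := neg_one_pow_sub_mul_eq_zero huv
  let a : ℝ × ℝ × ℝ := (1, 0, 0)
  let x : ℝ × ℝ × ℝ := (1, 1, 1)
  let b : ℝ × ℝ × ℝ := (-1, (-1) ^ s - 1, (-1) ^ u - 1)
  let y : ℝ × ℝ × ℝ := (-1, (-1) ^ t, (-1) ^ v)
  have hax : (monGraph s t u v).Adj (Sum.inl a) (Sum.inr x) := by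
    simp [monGraph_adj_inl_inr, a, x]
  have hbx : (monGraph s t u v).Adj (Sum.inl b) (Sum.inr x) := by
    simp [monGraph_adj_inl_inr, b, x]
  have hby : (monGraph s t u v).Adj (Sum.inl b) (Sum.inr y) := by
    rw [monGraph_adj_inl_inr]
    constructor <;> simp only [b, y] <;> linarith
  have hay : (monGraph s t u v).Adj (Sum.inl a) (Sum.inr y) := by
    simp [monGraph_adj_inl_inr, a, y]
  have hab : a ≠ b := fun e => by
    have := congrArg Prod.fst e
    norm_num [a, b] at this
  have hxy : x ≠ y := fun e => by
    have := congrArg Prod.fst e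
    norm_num [x, y] at this
  let w : (monGraph s t u v).Walk (Sum.inl a) (Sum.inl a) :=
    .cons hax (.cons hbx.symm (.cons hby (.cons hay.symm .nil)))
  have hw : w.IsCycle := by
    simp [w, SimpleGraph.Walk.cons_isCycle_iff, hab, hab.symm, hxy]
  exact SimpleGraph.egirth_le_length hw

theorem girth_four_iff (s t u v : ℕ) (hs : 0 < s) (ht : 0 < t) (hu : 0 < u) (hv : 0 < v) :
    (monGraph s t u v).egirth = 4 ↔ (Even s ∨ Even t) ∧ (Even u ∨ Even v) :=
  ⟨even_of_monGraph_egirth_eq_four, fun h =>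
    le_antisymm (monGraph_egirth_le_four h.1 h.2) (monGraph_four_le_egirth s t u v)⟩
end

section
/- Let s, t, u, v be positive integers such that s and t have the same parity, u and v have the same parity, and s, t, u, v are not all even. Then the graph Γ_ℝ(X^s Y^t, X^u Y^v) has girth six. -/
theorem adGraph_adj_inl_inr_s9 {R : Type*} [CommRing R] (f₂ f₃ : R × R → R) (a x : R × R × R) :
    (adGraph R f₂ f₃).Adj (Sum.inl a) (Sum.inr x) ↔
      a.2.1 + x.2.1 = f₂ (a.1, x.1) ∧ a.2.2 + x.2.2 = f₃ (a.1, x.1) := by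
  simp only [adGraph, SimpleGraph.fromRel_adj]
  constructor
  · rintro ⟨-, ⟨a', x', h, h', e⟩ | ⟨a', x', h, -⟩⟩
    · cases h; cases h'; exact e
    · cases h
  · exact fun h => ⟨by simp, Or.inl ⟨a, x, rfl, rfl, h⟩⟩

theorem adGraph_adj_isLeft {R : Type*} [CommRing R] {f₂ f₃ : R × R → R}
    {p q : (R × R × R) ⊕ (R × R × R)} (h : (adGraph R f₂ f₃).Adj p q) :
    q.isLeft = !p.isLeft := by
  simp only [adGraph, SimpleGraph.fromRel_adj] at h
  obtain ⟨-, ⟨a, x, rfl, rfl, -⟩ | ⟨a, x, rfl, rfl, -⟩⟩ := h <;> rfl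

/-- Two distinct points of `Γ_R(f₂, f₃)` have at most one common neighbour, as soon as the mixed
differences of `f₂` and `f₃` do not vanish simultaneously on a nondegenerate rectangle. -/
theorem adGraph_eq_of_common_neighbors {R : Type*} [CommRing R] {f₂ f₃ : R × R → R}
    (hf : ∀ a b x y : R, f₂ (a, x) - f₂ (b, x) = f₂ (a, y) - f₂ (b, y) →
      f₃ (a, x) - f₃ (b, x) = f₃ (a, y) - f₃ (b, y) → a = b ∨ x = y)
    {a b x y : R × R × R}
    (hax : (adGraph R f₂ f₃).Adj (Sum.inl a) (Sum.inr x))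
    (hbx : (adGraph R f₂ f₃).Adj (Sum.inl b) (Sum.inr x))
    (hay : (adGraph R f₂ f₃).Adj (Sum.inl a) (Sum.inr y))
    (hby : (adGraph R f₂ f₃).Adj (Sum.inl b) (Sum.inr y)) : a = b ∨ x = y := by
  rw [adGraph_adj_inl_inr_s9] at hax hbx hay hby
  obtain ⟨a₁, a₂, a₃⟩ := a
  obtain ⟨b₁, b₂, b₃⟩ := b
  obtain ⟨x₁, x₂, x₃⟩ := x
  obtain ⟨y₁, y₂, y₃⟩ := y
  simp only [Prod.mk.injEq] at *
  rcases hf a₁ b₁ x₁ y₁ (by linear_combination hay.1 - hby.1 - hax.1 + hbx.1)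
    (by linear_combination hay.2 - hby.2 - hax.2 + hbx.2) with rfl | rfl
  · exact Or.inl ⟨rfl, by linear_combination hax.1 - hbx.1, by linear_combination hax.2 - hbx.2⟩
  · exact Or.inr ⟨rfl, by linear_combination hax.1 - hay.1, by linear_combination hax.2 - hay.2⟩

theorem six_le_egirth_adGraph {R : Type*} [CommRing R] {f₂ f₃ : R × R → R}
    (hf : ∀ a b x y : R, f₂ (a, x) - f₂ (b, x) = f₂ (a, y) - f₂ (b, y) →
      f₃ (a, x) - f₃ (b, x) = f₃ (a, y) - f₃ (b, y) → a = b ∨ x = y) :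
    6 ≤ (adGraph R f₂ f₃).egirth := by
  rw [SimpleGraph.le_egirth]
  intro p w hw
  suffices 6 ≤ w.length by exact_mod_cast this
  have h3 := hw.three_le_length
  have hn := hw.support_nodup
  match w with
  | .nil => simp at h3
  | .cons _ .nil => simp at h3
  | .cons _ (.cons _ .nil) => simp at h3
  | .cons h₁ (.cons h₂ (.cons h₃ .nil)) =>
    have h := adGraph_adj_isLeft h₃
    rw [adGraph_adj_isLeft h₂, adGraph_adj_isLeft h₁] at h
    cases p <;> simp at h
  | .cons h₁ (.cons h₂ (.cons h₃ (.cons h₄ (.cons h₅ .nil)))) =>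
    have h := adGraph_adj_isLeft h₅
    rw [adGraph_adj_isLeft h₄, adGraph_adj_isLeft h₃, adGraph_adj_isLeft h₂,
      adGraph_adj_isLeft h₁] at h
    cases p <;> simp at h
  | .cons (v := q) h₁ (.cons (v := r) h₂ (.cons (v := m) h₃ (.cons h₄ .nil))) =>
    have e₁ := adGraph_adj_isLeft h₁
    have e₂ := adGraph_adj_isLeft h₂
    have e₃ := adGraph_adj_isLeft h₃
    simp only [SimpleGraph.Walk.support_cons, SimpleGraph.Walk.support_nil, List.tail_cons,
      List.nodup_cons, List.mem_cons, not_or] at hn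
    rcases p with a | x <;> rcases q with b | y <;> rcases r with c | z <;>
      rcases m with d | k <;> simp at e₁ e₂ e₃
    · rcases adGraph_eq_of_common_neighbors hf h₁ h₂.symm h₄.symm h₃ with rfl | rfl <;> simp at hn
    · rcases adGraph_eq_of_common_neighbors hf h₁.symm h₄ h₂ h₃.symm with rfl | rfl <;> simp at hn
  | .cons _ (.cons _ (.cons _ (.cons _ (.cons _ (.cons _ _))))) =>
    simp only [SimpleGraph.Walk.length_cons]; omega

/-- An explicit hexagon, with first coordinates `-1, 0, 1` on both sides. -/
theorem egirth_monGraph_le_six {s t u v : ℕ} (hs : 0 < s) (ht : 0 < t) (hu : 0 < u) (hv : 0 < v)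
    (hst : Even s ↔ Even t) (huv : Even u ↔ Even v) : (monGraph s t u v).egirth ≤ 6 := by
  have est : (-1 : ℝ) ^ t = (-1) ^ s := by simp only [neg_one_pow_eq_ite, hst]
  have euv : (-1 : ℝ) ^ v = (-1) ^ u := by simp only [neg_one_pow_eq_ite, huv]
  set ε : ℝ := (-1) ^ s with hε
  set δ : ℝ := (-1) ^ u with hδ
  have adj {a x : ℝ × ℝ × ℝ} (h₂ : a.2.1 + x.2.1 = a.1 ^ s * x.1 ^ t)
      (h₃ : a.2.2 + x.2.2 = a.1 ^ u * x.1 ^ v) :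
      (monGraph s t u v).Adj (Sum.inl a) (Sum.inr x) :=
    (adGraph_adj_inl_inr_s9 _ _ a x).2 ⟨h₂, h₃⟩
  have h₁ := adj (a := (-1, 0, 0)) (x := (1, ε, δ)) (by simp [hε]) (by simp [hδ])
  have h₂ := adj (a := (0, -ε, -δ)) (x := (1, ε, δ)) (by simp [hs.ne']) (by simp [hu.ne'])
  have h₃ := adj (a := (0, -ε, -δ)) (x := (-1, ε, δ)) (by simp [hs.ne']) (by simp [hu.ne'])
  have h₄ := adj (a := (1, 0, 0)) (x := (-1, ε, δ)) (by simp [est]) (by simp [euv])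
  have h₅ := adj (a := (1, 0, 0)) (x := (0, 0, 0)) (by simp [ht.ne']) (by simp [hv.ne'])
  have h₆ := adj (a := (-1, 0, 0)) (x := (0, 0, 0)) (by simp [ht.ne']) (by simp [hv.ne'])
  let w := SimpleGraph.Walk.cons h₁ (.cons h₂.symm (.cons h₃ (.cons h₄.symm (.cons h₅
    (.cons h₆.symm .nil)))))
  have hw : w.IsCycle := by
    have : (1 : ℝ) ≠ -1 := by norm_num
    have : (-1 : ℝ) ≠ 1 := by norm_num
    simp [w, SimpleGraph.Walk.cons_isCycle_iff, *]
  exact (SimpleGraph.egirth_le_length hw).trans (by simp [w])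

theorem eq_or_eq_of_odd_mixed_difference {m n : ℕ} (hm : Odd m) (hn : Odd n) {a b x y : ℝ}
    (h : a ^ m * x ^ n - b ^ m * x ^ n = a ^ m * y ^ n - b ^ m * y ^ n) : a = b ∨ x = y := by
  have : (a ^ m - b ^ m) * (x ^ n - y ^ n) = 0 := by linear_combination h
  rcases mul_eq_zero.1 this with h | h
  · exact Or.inl (hm.pow_injective (sub_eq_zero.1 h))
  · exact Or.inr (hn.pow_injective (sub_eq_zero.1 h))

theorem girth_six_same_parity (s t u v : ℕ) (hs : 0 < s) (ht : 0 < t) (hu : 0 < u) (hv : 0 < v)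
    (hst : Even s ↔ Even t) (huv : Even u ↔ Even v)
    (hnot : ¬(Even s ∧ Even t ∧ Even u ∧ Even v)) :
    (monGraph s t u v).egirth = 6 := by
  refine (egirth_monGraph_le_six hs ht hu hv hst huv).antisymm (six_le_egirth_adGraph ?_)
  intro a b x y h₂ h₃
  by_cases he : Even s
  · have hou : ¬Even u := fun h => hnot ⟨he, hst.1 he, h, huv.1 h⟩
    exact eq_or_eq_of_odd_mixed_difference (Nat.not_even_iff_odd.1 hou)
      (Nat.not_even_iff_odd.1 (huv.not.1 hou)) h₃
  · exact eq_or_eq_of_odd_mixed_difference (Nat.not_even_iff_odd.1 he)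
      (Nat.not_even_iff_odd.1 (hst.not.1 he)) h₂
end

section
/- Let m be a non-negative integer and t, v positive integers. Then the graphs Γ_ℝ(X^{2m+1} Y^t, X^{2m+1} Y^v) and Γ_ℝ(X Y^t, X Y^v) are isomorphic as graphs. -/
theorem pow_bijective_of_odd {n : ℕ} (hn : Odd n) :
    Function.Bijective (fun x : ℝ => x ^ n) := by
  refine ⟨hn.strictMono_pow.injective, fun y => ?_⟩
  have hn0 : n ≠ 0 := hn.pos.ne'
  rcases le_total 0 y with hy | hy
  · exact ⟨y ^ (n : ℝ)⁻¹, Real.rpow_inv_natCast_pow hy hn0⟩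
  · refine ⟨-(-y) ^ (n : ℝ)⁻¹, ?_⟩
    simp only [hn.neg_pow, Real.rpow_inv_natCast_pow (neg_nonneg.2 hy) hn0, neg_neg]

/-- Reparametrizing the first coordinate of the points by a bijection of the base ring
is a graph isomorphism. -/
def adGraphIsoOfEquiv {R : Type*} [CommRing R] (e : R ≃ R) (f₂ f₃ : R × R → R) :
    adGraph R (fun p => f₂ (e p.1, p.2)) (fun p => f₃ (e p.1, p.2)) ≃g adGraph R f₂ f₃ where
  toEquiv := Equiv.sumCongr (Equiv.prodCongr e (Equiv.refl _)) (Equiv.refl _)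
  map_rel_iff' := by
    rintro (⟨a, a₂, a₃⟩ | ⟨a, a₂, a₃⟩) (⟨b, b₂, b₃⟩ | ⟨b, b₂, b₃⟩) <;>
      simp [adGraph]

theorem iso_X_is_one (m t v : ℕ) (ht : 0 < t) (hv : 0 < v) :
    Nonempty (monGraph (2 * m + 1) t (2 * m + 1) v ≃g monGraph 1 t 1 v) := by
  have h := adGraphIsoOfEquiv
    (Equiv.ofBijective _ (pow_bijective_of_odd (odd_two_mul_add_one m)))
    (fun p => p.1 ^ 1 * p.2 ^ t) (fun p => p.1 ^ 1 * p.2 ^ v)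
  simp only [Equiv.ofBijective_apply, pow_one] at h
  simpa only [monGraph, pow_one] using Nonempty.intro h
end

section
/- Let k be a non-negative integer and n a positive integer with n > k, and let x ∈ ℝ. Then the function h_x(t) = (t^{2n} − x^{2n})/(t^{2k+1} − x^{2k+1}) is strictly increasing on ℝ \ {x}; that is, for all real t₁ < t₂ with t₁ ≠ x and t₂ ≠ x, h_x(t₁) < h_x(t₂). -/
theorem strictConvexOn_abs_rpow {p : ℝ} (hp : 1 < p) :
    StrictConvexOn ℝ Set.univ fun s : ℝ => |s| ^ p := by
  have hp0 : 0 < p := one_pos.trans hp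
  refine ⟨convex_univ, fun x _ y _ hxy a b ha hb hab => ?_⟩
  simp only [smul_eq_mul]
  have htri : |a * x + b * y| ≤ a * |x| + b * |y| := by
    simpa [abs_mul, abs_of_pos ha, abs_of_pos hb] using abs_add_le (a * x) (b * y)
  by_cases h : |x| = |y|
  · obtain rfl : x = -y := (abs_eq_abs.mp h).resolve_left hxy
    have hy : 0 < |y| := abs_pos.mpr fun hy => hxy (by simp [hy])
    have hcoef : |b - a| < 1 := abs_lt.mpr ⟨by linarith, by linarith⟩
    have hlt : |a * -y + b * y| < |y| := by
      rw [show a * -y + b * y = (b - a) * y by ring, abs_mul]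
      exact mul_lt_of_lt_one_left hy hcoef
    calc |a * -y + b * y| ^ p < |y| ^ p := Real.rpow_lt_rpow (abs_nonneg _) hlt hp0
      _ = a * |-y| ^ p + b * |y| ^ p := by rw [abs_neg, ← add_mul, hab, one_mul]
  · calc |a * x + b * y| ^ p ≤ (a * |x| + b * |y|) ^ p :=
        Real.rpow_le_rpow (abs_nonneg _) htri hp0.le
      _ < a * |x| ^ p + b * |y| ^ p :=
        (strictConvexOn_rpow hp).2 (abs_nonneg x) (abs_nonneg y) h ha hb hab

theorem abs_odd_pow_rpow_div (k n : ℕ) (t : ℝ) :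
    |t ^ (2 * k + 1)| ^ (((2 * n : ℕ) : ℝ) / ((2 * k + 1 : ℕ) : ℝ)) = t ^ (2 * n) := by
  have hm : ((2 * k + 1 : ℕ) : ℝ) ≠ 0 := Nat.cast_ne_zero.mpr (by omega)
  rw [abs_pow, ← Real.rpow_natCast, ← Real.rpow_mul (abs_nonneg t), mul_div_cancel₀ _ hm,
    Real.rpow_natCast, (even_two_mul n).pow_abs]

theorem h_strict_mono (k n : ℕ) (hn : 0 < n) (hkn : k < n) (x : ℝ)
    (t₁ t₂ : ℝ) (h12 : t₁ < t₂) (h1 : t₁ ≠ x) (h2 : t₂ ≠ x) :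
    (t₁ ^ (2 * n) - x ^ (2 * n)) / (t₁ ^ (2 * k + 1) - x ^ (2 * k + 1)) <
      (t₂ ^ (2 * n) - x ^ (2 * n)) / (t₂ ^ (2 * k + 1) - x ^ (2 * k + 1)) := by
  have hodd : StrictMono fun t : ℝ => t ^ (2 * k + 1) := Odd.strictMono_pow ⟨k, rfl⟩
  have hp : 1 < ((2 * n : ℕ) : ℝ) / ((2 * k + 1 : ℕ) : ℝ) := by
    rw [one_lt_div (Nat.cast_pos.mpr (by omega))]
    exact Nat.cast_lt.mpr (by omega)
  have hslope := (strictConvexOn_abs_rpow hp).secant_strict_mono (Set.mem_univ _) (Set.mem_univ _)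
    (Set.mem_univ _) (hodd.injective.ne h1) (hodd.injective.ne h2) (hodd h12)
  simpa only [abs_odd_pow_rpow_div] using hslope
end

section
/- Let k be a non-negative integer and n a positive integer with n > k, and let x be a nonzero real number. Then for all real t ≠ x, one has (2n − 2k − 1)·t^{2n} − 2n·x^{2k+1}·t^{2n−2k−1} + (2k+1)·x^{2n} > 0. -/
theorem pow_succ_sub_pow_succ_mul_pos {u v : ℝ} (hu : 0 ≤ u) (hv : 0 ≤ v) (h : u ≠ v)
    (a b : ℕ) : 0 < (u ^ (a + 1) - v ^ (a + 1)) * (u ^ (b + 1) - v ^ (b + 1)) := by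
  rcases lt_or_gt_of_ne h with h | h
  · exact mul_pos_of_neg_of_neg (sub_neg.2 (pow_lt_pow_left₀ h hu a.succ_ne_zero))
      (sub_neg.2 (pow_lt_pow_left₀ h hu b.succ_ne_zero))
  · exact mul_pos (sub_pos.2 (pow_lt_pow_left₀ h hv a.succ_ne_zero))
      (sub_pos.2 (pow_lt_pow_left₀ h hv b.succ_ne_zero))

theorem pow_succ_sub_pow_succ_le {u v : ℝ} (hu : 0 ≤ u) (hv : 0 ≤ v) (h : u ≠ v) (a : ℕ) :
    u ^ (a + 1) - v ^ (a + 1) ≤ (a + 1) * u ^ a * (u - v) := by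
  induction a with
  | zero => simp
  | succ a ih =>
    have h₁ := mul_le_mul_of_nonneg_left ih hu
    have h₂ := pow_succ_sub_pow_succ_mul_pos hu hv h a 0
    push_cast
    ring_nf at h₁ h₂ ⊢
    linarith

/-- Strict weighted AM-GM inequality with positive integer weights. -/
theorem add_mul_pow_mul_pow_lt {u v : ℝ} (hu : 0 ≤ u) (hv : 0 ≤ v) (h : u ≠ v) (a b : ℕ) :
    ((a + 1 : ℝ) + (b + 1)) * (u ^ (a + 1) * v ^ (b + 1)) <
      (a + 1) * u ^ (a + b + 2) + (b + 1) * v ^ (a + b + 2) := by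
  have tangent := pow_succ_sub_pow_succ_le hu hv h a
  induction b with
  | zero =>
    have h₁ := mul_le_mul_of_nonneg_left tangent hu
    have h₂ := pow_succ_sub_pow_succ_mul_pos hu hv h a 0
    push_cast
    ring_nf at h₁ h₂ ⊢
    linarith
  | succ b ih =>
    have h₀ := mul_le_mul_of_nonneg_left ih.le hv
    have h₁ := mul_le_mul_of_nonneg_left tangent (pow_nonneg hu (b + 2))
    have h₂ := pow_succ_sub_pow_succ_mul_pos hu hv h a (b + 1)
    push_cast
    ring_nf at h₀ h₁ h₂ ⊢
    linarith

theorem H_pos (k n : ℕ) (hn : 0 < n) (hkn : k < n) (x : ℝ) (hx : x ≠ 0)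
    (t : ℝ) (ht : t ≠ x) :
    0 < (2 * (n : ℝ) - 2 * (k : ℝ) - 1) * t ^ (2 * n) -
        2 * (n : ℝ) * x ^ (2 * k + 1) * t ^ (2 * n - 2 * k - 1) +
        (2 * (k : ℝ) + 1) * x ^ (2 * n) := by
  obtain ⟨m, rfl⟩ : ∃ m, n = k + m + 1 := ⟨n - k - 1, by omega⟩
  rw [show 2 * (k + m + 1) - 2 * k - 1 = 2 * m + 1 by omega]
  have hx2 : 0 < x ^ (2 * (k + m + 1)) := (even_two_mul _).pow_pos hx
  by_cases habs : |x| = |t|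
  · obtain rfl : t = -x := by
      rcases abs_eq_abs.1 habs with h | h
      · exact absurd h.symm ht
      · linarith
    rw [(even_two_mul _).neg_pow, (odd_two_mul_add_one m).neg_pow]
    have h := mul_pos (show (0 : ℝ) < 4 * (k + m + 1) by positivity) hx2
    push_cast
    ring_nf at h ⊢
    linarith
  · have h := add_mul_pow_mul_pow_lt (abs_nonneg x) (abs_nonneg t) habs (2 * k) (2 * m)
    rw [show 2 * k + 2 * m + 2 = 2 * (k + m + 1) by ring, (even_two_mul _).pow_abs,
      (even_two_mul _).pow_abs, ← abs_pow, ← abs_pow, ← abs_mul] at h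
    have hle := mul_le_mul_of_nonneg_left (le_abs_self (x ^ (2 * k + 1) * t ^ (2 * m + 1)))
      (show (0 : ℝ) ≤ (2 * k + 1) + (2 * m + 1) by positivity)
    push_cast at h ⊢
    linarith
end

section
/- For any two edges of the graph Γ_ℝ(XY, XY²), say with endpoints a point p adjacent to a line l and a point p′ adjacent to a line l′, there exists a graph automorphism of Γ_ℝ(XY, XY²) mapping p to p′ and l to l′. In particular, the automorphism group of Γ_ℝ(XY, XY²) acts transitively on the set of points, transitively on the set of lines, and the graph is edge-transitive. -/
theorem monGraph_adj_inl_inr_s19 {s t u v : ℕ} {p l : ℝ × ℝ × ℝ} :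
    (monGraph s t u v).Adj (Sum.inl p) (Sum.inr l) ↔
      p.2.1 + l.2.1 = p.1 ^ s * l.1 ^ t ∧ p.2.2 + l.2.2 = p.1 ^ u * l.1 ^ v := by
  rcases p with ⟨p₁, p₂, p₃⟩
  rcases l with ⟨l₁, l₂, l₃⟩
  simp [monGraph, adGraph, and_assoc]

theorem not_monGraph_adj_inl_inl {s t u v : ℕ} {p q : ℝ × ℝ × ℝ} :
    ¬ (monGraph s t u v).Adj (Sum.inl p) (Sum.inl q) := by
  simp [monGraph, adGraph]

theorem not_monGraph_adj_inr_inr {s t u v : ℕ} {l m : ℝ × ℝ × ℝ} :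
    ¬ (monGraph s t u v).Adj (Sum.inr l) (Sum.inr m) := by
  simp [monGraph, adGraph]

/-- The action on points of the automorphism of `Γ_ℝ(XY, XY²)` that shifts the first coordinate of
points by `c` and that of lines by `d`. -/
def pointShift (c d s t : ℝ) : (ℝ × ℝ × ℝ) ≃ (ℝ × ℝ × ℝ) where
  toFun p := (p.1 + c, p.2.1 + d * p.1 + s, p.2.2 + 2 * d * p.2.1 + d ^ 2 * p.1 + t)
  invFun q := (q.1 - c, q.2.1 - s - d * (q.1 - c),
    q.2.2 - t - 2 * d * (q.2.1 - s - d * (q.1 - c)) - d ^ 2 * (q.1 - c))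
  left_inv p := by ext <;> simp; ring
  right_inv q := by ext <;> simp; ring

/-- The action on lines of the automorphism of `Γ_ℝ(XY, XY²)` that shifts the first coordinate of
points by `c` and that of lines by `d`. -/
def lineShift (c d s t : ℝ) : (ℝ × ℝ × ℝ) ≃ (ℝ × ℝ × ℝ) where
  toFun l := (l.1 + d, l.2.1 + c * (l.1 + d) - s, l.2.2 + 2 * d * l.2.1 + c * (l.1 + d) ^ 2 - t)
  invFun m := (m.1 - d, m.2.1 + s - c * m.1,
    m.2.2 + t - 2 * d * (m.2.1 + s - c * m.1) - c * m.1 ^ 2)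
  left_inv l := by ext <;> simp; ring
  right_inv m := by ext <;> simp; ring

theorem pointShift_adj_lineShift (c d s t : ℝ) (p l : ℝ × ℝ × ℝ) :
    (monGraph 1 1 1 2).Adj (Sum.inl (pointShift c d s t p)) (Sum.inr (lineShift c d s t l)) ↔
      (monGraph 1 1 1 2).Adj (Sum.inl p) (Sum.inr l) := by
  simp only [monGraph_adj_inl_inr_s19, pointShift, lineShift, Equiv.coe_fn_mk]
  constructor
  · rintro ⟨h₂, h₃⟩
    have h : p.2.1 + l.2.1 = p.1 ^ 1 * l.1 ^ 1 := by linear_combination h₂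
    exact ⟨h, by linear_combination h₃ - 2 * d * h⟩
  · rintro ⟨h₂, h₃⟩
    exact ⟨by linear_combination h₂, by linear_combination h₃ + 2 * d * h₂⟩

/-- The automorphism of `Γ_ℝ(XY, XY²)` given by `pointShift` and `lineShift`. -/
noncomputable def shiftIso (c d s t : ℝ) : monGraph 1 1 1 2 ≃g monGraph 1 1 1 2 where
  toEquiv := Equiv.sumCongr (pointShift c d s t) (lineShift c d s t)
  map_rel_iff' := by
    rintro (p | l) (q | m)
    · simp [not_monGraph_adj_inl_inl]
    · exact pointShift_adj_lineShift c d s t p m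
    · rw [SimpleGraph.adj_comm, SimpleGraph.adj_comm _ (Sum.inr l)]
      exact pointShift_adj_lineShift c d s t q l
    · simp [not_monGraph_adj_inr_inr]

theorem exists_iso_of_adj {p l p' l' : ℝ × ℝ × ℝ}
    (h : (monGraph 1 1 1 2).Adj (Sum.inl p) (Sum.inr l))
    (h' : (monGraph 1 1 1 2).Adj (Sum.inl p') (Sum.inr l')) :
    ∃ φ : monGraph 1 1 1 2 ≃g monGraph 1 1 1 2,
      φ (Sum.inl p) = Sum.inl p' ∧ φ (Sum.inr l) = Sum.inr l' := by
  let c := p'.1 - p.1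
  let d := l'.1 - l.1
  let s := p'.2.1 - p.2.1 - d * p.1
  let t := p'.2.2 - p.2.2 - 2 * d * p.2.1 - d ^ 2 * p.1
  have hp : pointShift c d s t p = p' := by
    ext <;> simp only [pointShift, Equiv.coe_fn_mk, c, s, t] <;> ring
  have hl₁ : (lineShift c d s t l).1 = l'.1 := by simp [lineShift, d]
  have hadj := (pointShift_adj_lineShift c d s t p l).2 h
  rw [hp, monGraph_adj_inl_inr_s19, hl₁] at hadj
  rw [monGraph_adj_inl_inr_s19] at h'
  have hl : lineShift c d s t l = l' :=
    Prod.ext hl₁ (Prod.ext (by linear_combination hadj.1 - h'.1)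
      (by linear_combination hadj.2 - h'.2))
  exact ⟨shiftIso c d s t, congrArg Sum.inl hp, congrArg Sum.inr hl⟩

theorem exists_monGraph_adj_inr (s t u v : ℕ) (p : ℝ × ℝ × ℝ) :
    ∃ l, (monGraph s t u v).Adj (Sum.inl p) (Sum.inr l) :=
  ⟨(0, p.1 ^ s * 0 ^ t - p.2.1, p.1 ^ u * 0 ^ v - p.2.2),
    monGraph_adj_inl_inr_s19.2 ⟨by ring, by ring⟩⟩

theorem exists_monGraph_adj_inl (s t u v : ℕ) (l : ℝ × ℝ × ℝ) :
    ∃ p, (monGraph s t u v).Adj (Sum.inl p) (Sum.inr l) :=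
  ⟨(0, 0 ^ s * l.1 ^ t - l.2.1, 0 ^ u * l.1 ^ v - l.2.2),
    monGraph_adj_inl_inr_s19.2 ⟨by ring, by ring⟩⟩

theorem edge_transitive :
    (∀ p l p' l' : ℝ × ℝ × ℝ,
        (monGraph 1 1 1 2).Adj (Sum.inl p) (Sum.inr l) →
        (monGraph 1 1 1 2).Adj (Sum.inl p') (Sum.inr l') →
        ∃ φ : monGraph 1 1 1 2 ≃g monGraph 1 1 1 2,
          φ (Sum.inl p) = Sum.inl p' ∧ φ (Sum.inr l) = Sum.inr l') ∧
    (∀ p p' : ℝ × ℝ × ℝ, ∃ φ : monGraph 1 1 1 2 ≃g monGraph 1 1 1 2,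
        φ (Sum.inl p) = Sum.inl p') ∧
    (∀ l l' : ℝ × ℝ × ℝ, ∃ φ : monGraph 1 1 1 2 ≃g monGraph 1 1 1 2,
        φ (Sum.inr l) = Sum.inr l') := by
  refine ⟨fun _ _ _ _ => exists_iso_of_adj, fun p p' => ?_, fun l l' => ?_⟩
  · obtain ⟨l, h⟩ := exists_monGraph_adj_inr 1 1 1 2 p
    obtain ⟨l', h'⟩ := exists_monGraph_adj_inr 1 1 1 2 p'
    exact (exists_iso_of_adj h h').imp fun _ hφ => hφ.1
  · obtain ⟨p, h⟩ := exists_monGraph_adj_inl 1 1 1 2 l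
    obtain ⟨p', h'⟩ := exists_monGraph_adj_inl 1 1 1 2 l'
    exact (exists_iso_of_adj h h').imp fun _ hφ => hφ.2
end
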